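/- arXiv:1701.07757 — 2 statements merged into one kernel-verified Lean document; each statement's English description precedes it below -/
import Mathlib

section
/- Let ρ = (1/2)(|00⟩⟨00| + |++⟩⟨++|) on ℂ² ⊗ ℂ², where |++⟩ = |+⟩⊗|+⟩. Let |ψ₀⟩ = (|00⟩ + |++⟩)/√3 and |ψ₁⟩ = |00⟩ − |++⟩. Then |ψ₀⟩ and |ψ₁⟩ are orthonormal, ρ = (3/4)|ψ₀⟩⟨ψ₀| + (1/4)|ψ₁⟩⟨ψ₁|, ρ is separable, and yet neither |ψ₀⟩ nor |ψ₁⟩ is a product vector (i.e. neither equals v ⊗ w for vectors v, w ∈ ℂ²). Thus a separable state need not have an eigenbasis of product vectors. -/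
open Matrix Kronecker BigOperators
open scoped ComplexOrder

noncomputable section

/-- A quantum state: positive semidefinite, trace one. -/
def IsState {n : Type*} [Fintype n] [DecidableEq n] (ρ : Matrix n n ℂ) : Prop :=
  ρ.PosSemidef ∧ ρ.trace = 1

/-- Separability on a bipartite system `ℂ^dA ⊗ ℂ^dB`. -/
def SeparableState {dA dB : ℕ} (ρ : Matrix (Fin dA × Fin dB) (Fin dA × Fin dB) ℂ) : Prop :=
  ∃ (m : ℕ) (p : Fin m → ℝ) (A : Fin m → Matrix (Fin dA) (Fin dA) ℂ)
    (B : Fin m → Matrix (Fin dB) (Fin dB) ℂ),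
    (∀ k, 0 ≤ p k) ∧ (∑ k, p k) = 1 ∧ (∀ k, IsState (A k)) ∧ (∀ k, IsState (B k)) ∧
    ρ = ∑ k, ((p k : ℂ) • (A k ⊗ₖ B k))

/-- An entangled state is a state that is not separable. -/
def EntangledState {dA dB : ℕ} (ρ : Matrix (Fin dA × Fin dB) (Fin dA × Fin dB) ℂ) : Prop :=
  IsState ρ ∧ ¬ SeparableState ρ

/-- Trace distance: half the sum of absolute values of the eigenvalues of `ρ - τ`. -/
def traceDist {n : Type*} [Fintype n] [DecidableEq n] (ρ τ : Matrix n n ℂ) : ℝ :=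
  if h : (ρ - τ).IsHermitian then (1/2) * ∑ i, |h.eigenvalues i| else 0

/-- Standard basis vector of `ℂ^d`. -/
def bv {d : ℕ} (a : ℕ) (h : a < d) : Fin d → ℂ := Pi.single ⟨a, h⟩ (1 : ℂ)

/-- Standard basis of `ℂ²`. -/
def ket2 (a : Fin 2) : Fin 2 → ℂ := Pi.single a 1

/-- Standard basis of `ℂ³`. -/
def ket3 (a : Fin 3) : Fin 3 → ℂ := Pi.single a 1

/-- `|+⟩ = (|0⟩+|1⟩)/√2`. -/
def ketPlus : Fin 2 → ℂ := (Real.sqrt 2 : ℂ)⁻¹ • (ket2 0 + ket2 1)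

/-- `|−⟩ = (|0⟩−|1⟩)/√2`. -/
def ketMinus : Fin 2 → ℂ := (Real.sqrt 2 : ℂ)⁻¹ • (ket2 0 - ket2 1)

/-- Kronecker product of vectors. -/
def vecKron {dA dB : ℕ} (v : Fin dA → ℂ) (w : Fin dB → ℂ) : Fin dA × Fin dB → ℂ :=
  fun p => v p.1 * w p.2

/-- `|ψ₊⟩ = (|01⟩+|10⟩)/√2`. -/
def psiPlus : Fin 2 × Fin 2 → ℂ :=
  (Real.sqrt 2 : ℂ)⁻¹ • (vecKron (ket2 0) (ket2 1) + vecKron (ket2 1) (ket2 0))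

/-- `|φ₊⟩ = (|00⟩+|11⟩)/√2`. -/
def phiPlus : Fin 2 × Fin 2 → ℂ :=
  (Real.sqrt 2 : ℂ)⁻¹ • (vecKron (ket2 0) (ket2 0) + vecKron (ket2 1) (ket2 1))

/-- The projector `|v⟩⟨v|`. -/
def proj {n : Type*} (v : n → ℂ) : Matrix n n ℂ := vecMulVec v (star v)

/-- Partial transpose on the first factor. -/
def PT {dA dB : ℕ} (ρ : Matrix (Fin dA × Fin dB) (Fin dA × Fin dB) ℂ) :
    Matrix (Fin dA × Fin dB) (Fin dA × Fin dB) ℂ :=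
  Matrix.of fun p q => ρ (q.1, p.2) (p.1, q.2)

/-- `⟨v|M|w⟩`. -/
def braket {n : Type*} [Fintype n] (v : n → ℂ) (M : Matrix n n ℂ) (w : n → ℂ) : ℂ :=
  star v ⬝ᵥ (M *ᵥ w)

/-- A state is classical with respect to the family of vectors `v` on the `A` side. -/
def ClassicalWrt {dA dB : ℕ} (v : Fin dA → Fin dA → ℂ)
    (ρ : Matrix (Fin dA × Fin dB) (Fin dA × Fin dB) ℂ) : Prop :=
  ∃ (lam : Fin dA → ℝ) (τ : Fin dA → Matrix (Fin dB) (Fin dB) ℂ),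
    (∀ i, 0 ≤ lam i) ∧ (∀ i, IsState (τ i)) ∧
    ρ = ∑ i, ((lam i : ℂ) • (proj (v i) ⊗ₖ τ i))

/-- Orthonormality of a family of `dA` vectors of `ℂ^dA` (hence an orthonormal basis). -/
def IsONBasis {d : ℕ} (v : Fin d → Fin d → ℂ) : Prop :=
  ∀ i j, star (v i) ⬝ᵥ v j = if i = j then 1 else 0

/-- A state is classical with respect to `A` if it is classical w.r.t. some
orthonormal basis of `ℂ^dA`; otherwise it is discordant. -/
def ClassicalA {dA dB : ℕ} (ρ : Matrix (Fin dA × Fin dB) (Fin dA × Fin dB) ℂ) : Prop :=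
  ∃ v : Fin dA → Fin dA → ℂ, IsONBasis v ∧ ClassicalWrt v ρ

/-- Hamming weight of a natural number (number of ones in binary). -/
def hammingWt (n : ℕ) : ℕ := (Nat.digits 2 n).sum

theorem proj_vecKron {dA dB : ℕ} (v : Fin dA → ℂ) (w : Fin dB → ℂ) :
    proj (vecKron v w) = proj v ⊗ₖ proj w := by
  ext ⟨i, j⟩ ⟨k, l⟩
  simp only [proj, vecKron, vecMulVec_apply, kroneckerMap_apply, Pi.star_apply, star_mul']
  ring

theorem isState_proj {n : Type*} [Fintype n] [DecidableEq n] {v : n → ℂ}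
    (hv : star v ⬝ᵥ v = 1) : IsState (proj v) :=
  ⟨posSemidef_vecMulVec_self_star v, by rw [proj, trace_vecMulVec, dotProduct_comm, hv]⟩

theorem vecKron_minor {dA dB : ℕ} (v : Fin dA → ℂ) (w : Fin dB → ℂ) (i k : Fin dA)
    (j l : Fin dB) :
    vecKron v w (i, j) * vecKron v w (k, l) = vecKron v w (i, l) * vecKron v w (k, j) := by
  simp only [vecKron]
  ring

theorem inv_sqrt_mul_self {x : ℝ} (hx : 0 ≤ x) :
    (Real.sqrt x : ℂ)⁻¹ * (Real.sqrt x : ℂ)⁻¹ = (x : ℂ)⁻¹ := by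
  rw [← mul_inv, ← Complex.ofReal_mul, Real.mul_self_sqrt hx]

theorem vecKron_ketPlus_ketPlus : vecKron ketPlus ketPlus = fun _ => (1 / 2 : ℂ) := by
  have h := inv_sqrt_mul_self (x := 2) (by norm_num)
  ext ⟨i, j⟩
  fin_cases i <;> fin_cases j <;> simpa [vecKron, ketPlus, ket2] using h

theorem dotProduct_ket2 (a : Fin 2) : star (ket2 a) ⬝ᵥ ket2 a = 1 := by
  simp [ket2]

theorem dotProduct_ketPlus : star ketPlus ⬝ᵥ ketPlus = 1 := by
  have h := inv_sqrt_mul_self (x := 2) (by norm_num)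
  push_cast at h
  simp [ketPlus, ket2, dotProduct, Fin.sum_univ_two, h]
  norm_num

theorem proj_smul {n : Type*} (c : ℂ) (v : n → ℂ) :
    proj (c • v) = (c * star c) • proj v := by
  ext i j
  simp only [proj, vecMulVec_apply, Pi.star_apply, Pi.smul_apply, smul_eq_mul, star_mul',
    Matrix.smul_apply]
  ring

theorem proj_add_add_proj_sub {n : Type*} (v w : n → ℂ) :
    proj (v + w) + proj (v - w) = (2 : ℂ) • (proj v + proj w) := by
  ext i j
  simp only [proj, vecMulVec_apply, Pi.star_apply, Pi.add_apply, Pi.sub_apply, smul_eq_mul,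
    star_add, star_sub, Matrix.smul_apply, Matrix.add_apply]
  ring

theorem separableState_half_add {dA dB : ℕ} {a c : Fin dA → ℂ} {b d : Fin dB → ℂ}
    (ha : star a ⬝ᵥ a = 1) (hb : star b ⬝ᵥ b = 1) (hc : star c ⬝ᵥ c = 1)
    (hd : star d ⬝ᵥ d = 1) :
    SeparableState ((1/2 : ℂ) • (proj (vecKron a b) + proj (vecKron c d))) := by
  refine ⟨2, fun _ => 1/2, ![proj a, proj c], ![proj b, proj d], fun _ => by norm_num,
    by norm_num, ?_, ?_, ?_⟩
  · exact Fin.forall_fin_two.2 ⟨isState_proj ha, isState_proj hc⟩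
  · exact Fin.forall_fin_two.2 ⟨isState_proj hb, isState_proj hd⟩
  · simp [proj_vecKron, Fin.sum_univ_two]

/-- `ρ = (1/2)(|00⟩⟨00| + |++⟩⟨++|)` has the spectral decomposition
`ρ = (3/4)|ψ₀⟩⟨ψ₀| + (1/4)|ψ₁⟩⟨ψ₁|` with `ψ₀, ψ₁` orthonormal, `ρ` is separable, yet
neither `ψ₀` nor `ψ₁` is a product vector. -/
theorem stmt_5 (ρ : Matrix (Fin 2 × Fin 2) (Fin 2 × Fin 2) ℂ)
    (hρ : ρ = (1/2 : ℂ) •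
      (proj (vecKron (ket2 0) (ket2 0)) + proj (vecKron ketPlus ketPlus)))
    (ψ0 ψ1 : Fin 2 × Fin 2 → ℂ)
    (hψ0 : ψ0 = (Real.sqrt 3 : ℂ)⁻¹ •
      (vecKron (ket2 0) (ket2 0) + vecKron ketPlus ketPlus))
    (hψ1 : ψ1 = vecKron (ket2 0) (ket2 0) - vecKron ketPlus ketPlus) :
    star ψ0 ⬝ᵥ ψ0 = 1 ∧ star ψ1 ⬝ᵥ ψ1 = 1 ∧ star ψ0 ⬝ᵥ ψ1 = 0 ∧
    ρ = (3/4 : ℂ) • proj ψ0 + (1/4 : ℂ) • proj ψ1 ∧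
    SeparableState ρ ∧
    (¬ ∃ (v : Fin 2 → ℂ) (w : Fin 2 → ℂ), ψ0 = vecKron v w) ∧
    (¬ ∃ (v : Fin 2 → ℂ) (w : Fin 2 → ℂ), ψ1 = vecKron v w) := by
  have h3 := inv_sqrt_mul_self (x := 3) (by norm_num)
  push_cast at h3
  have hs : (Real.sqrt 3 : ℂ)⁻¹ * star (Real.sqrt 3 : ℂ)⁻¹ = 3⁻¹ := by
    simpa using h3
  refine ⟨?_, ?_, ?_, ?_, ?_, ?_, ?_⟩
  · rw [hψ0, star_smul, smul_dotProduct, dotProduct_smul, smul_smul, mul_comm, hs,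
      vecKron_ketPlus_ketPlus]
    simp [vecKron, ket2, dotProduct, Fintype.sum_prod_type, Fin.sum_univ_two]
    norm_num
  · rw [hψ1, vecKron_ketPlus_ketPlus]
    simp [vecKron, ket2, dotProduct, Fintype.sum_prod_type, Fin.sum_univ_two]
    norm_num
  · rw [hψ0, hψ1, star_smul, smul_dotProduct, vecKron_ketPlus_ketPlus]
    simp [vecKron, ket2, dotProduct, Fintype.sum_prod_type, Fin.sum_univ_two]
    norm_num
  · rw [hρ, hψ0, hψ1, proj_smul, hs, smul_smul, show (3/4 : ℂ) * 3⁻¹ = 1/4 by norm_num,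
      ← smul_add, proj_add_add_proj_sub, smul_smul]
    norm_num
  · rw [hρ]
    exact separableState_half_add (dotProduct_ket2 0) (dotProduct_ket2 0) dotProduct_ketPlus
      dotProduct_ketPlus
  · rintro ⟨v, w, h⟩
    have hm := vecKron_minor v w 0 1 0 1
    rw [← h, hψ0, vecKron_ketPlus_ketPlus] at hm
    simp only [Pi.smul_apply, smul_eq_mul, mul_mul_mul_comm, h3] at hm
    simp [vecKron, ket2] at hm
  · rintro ⟨v, w, h⟩
    have hm := vecKron_minor v w 0 1 0 1
    rw [← h, hψ1, vecKron_ketPlus_ketPlus] at hm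
    simp [vecKron, ket2] at hm
    norm_num at hm
end
end

section
/- Let dA, dB ≥ 2 and write |ab⟩ = e_a ⊗ e_b for the Kronecker products of standard basis vectors of ℂ^{dA} and ℂ^{dB}. Let ρ₀ be a state on ℂ^{dA} ⊗ ℂ^{dB} with ⟨00|ρ₀|00⟩ = 0 and ⟨10|ρ₀|01⟩ = 0, and let ρ₁ be a state with ⟨00|ρ₁|00⟩ = 0 and ⟨10|ρ₁|01⟩ ≠ 0. Then for every ε with 0 < ε ≤ 1, the state ρ_ε = (1−ε)ρ₀ + ερ₁ is entangled; moreover there exist complex numbers a, b such that the vector Ψ = a|00⟩ + b|11⟩ satisfies ⟨Ψ| PT(ρ_ε) |Ψ⟩ < 0. -/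
open Matrix Kronecker BigOperators
open scoped ComplexOrder

noncomputable section

lemma IsState.convexComb {n : Type*} [Fintype n] [DecidableEq n] {ρ τ : Matrix n n ℂ}
    (hρ : IsState ρ) (hτ : IsState τ) {ε : ℝ} (hε0 : 0 ≤ ε) (hε1 : ε ≤ 1) :
    IsState ((1 - (ε : ℂ)) • ρ + (ε : ℂ) • τ) := by
  have hε : (0 : ℂ) ≤ (ε : ℂ) := by exact_mod_cast hε0
  have hε' : (0 : ℂ) ≤ 1 - (ε : ℂ) := by
    have : (0 : ℝ) ≤ 1 - ε := by linarith
    exact_mod_cast this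
  refine ⟨(hρ.1.smul hε').add (hτ.1.smul hε), ?_⟩
  rw [trace_add, trace_smul, trace_smul, hρ.2, hτ.2]
  simp

/-- The partial transpose of a separable state is positive semidefinite. -/
lemma SeparableState.posSemidef_PT {dA dB : ℕ}
    {ρ : Matrix (Fin dA × Fin dB) (Fin dA × Fin dB) ℂ} (h : SeparableState ρ) :
    (PT ρ).PosSemidef := by
  obtain ⟨m, p, A, B, hp, -, hA, hB, rfl⟩ := h
  have key : PT (∑ k, ((p k : ℂ) • (A k ⊗ₖ B k))) = ∑ k, ((p k : ℂ) • ((A k)ᵀ ⊗ₖ B k)) := by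
    ext x y
    simp [PT, Matrix.sum_apply]
  rw [key]
  refine posSemidef_sum _ fun k _ => ?_
  exact ((hA k).1.transpose.kronecker (hB k).1).smul (by exact_mod_cast hp k)

lemma vecKron_bv {dA dB i j : ℕ} (hi : i < dA) (hj : j < dB) :
    vecKron (bv i hi) (bv j hj) = Pi.single (⟨i, hi⟩, ⟨j, hj⟩) (1 : ℂ) := by
  ext ⟨x, y⟩
  by_cases hx : x = ⟨i, hi⟩ <;> by_cases hy : y = ⟨j, hj⟩ <;>
    simp [vecKron, bv, hx, hy]

lemma braket_single {n : Type*} [Fintype n] [DecidableEq n] (M : Matrix n n ℂ) (x y : n) :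
    braket (Pi.single x 1) M (Pi.single y 1) = M x y := by
  simp [braket]

lemma braket_add_smul_single {n : Type*} [Fintype n] [DecidableEq n] (M : Matrix n n ℂ)
    (x y : n) (a b : ℂ) :
    braket (a • Pi.single x 1 + b • Pi.single y 1) M (a • Pi.single x 1 + b • Pi.single y 1) =
      star a * a * M x x + star a * b * M x y + star b * a * M y x + star b * b * M y y := by
  simp [braket, mulVec_add, mulVec_smul]
  ring

/-- A Hermitian matrix with a zero diagonal entry in a row with a nonzero off-diagonal entry takes
a negative value on a vector supported on the two indices involved. -/
lemma exists_braket_neg {n : Type*} [Fintype n] [DecidableEq n] {M : Matrix n n ℂ}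
    (hM : M.IsHermitian) {x y : n} (hx : M x x = 0) (hxy : M x y ≠ 0) :
    ∃ a b : ℂ, ∃ r : ℝ, r < 0 ∧
      braket (a • Pi.single x 1 + b • Pi.single y 1) M
        (a • Pi.single x 1 + b • Pi.single y 1) = (r : ℂ) := by
  have hyx : M y x = star (M x y) := (hM.apply y x).symm
  obtain ⟨d, hd⟩ : ∃ d : ℝ, M y y = d := ⟨_, (Complex.conj_eq_iff_re.mp (hM.apply y y)).symm⟩
  have hpos : 0 < Complex.normSq (M x y) := Complex.normSq_pos.mpr hxy
  refine ⟨-((|d| + 1 : ℝ) : ℂ), star (M x y),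
    Complex.normSq (M x y) * (d - 2 * (|d| + 1)),
    mul_neg_of_pos_of_neg hpos (by linarith [le_abs_self d, abs_nonneg d]), ?_⟩
  rw [braket_add_smul_single, hx, hyx, hd]
  push_cast [Complex.normSq_eq_conj_mul_self]
  simp only [star_neg, Complex.star_def, map_add, Complex.conj_ofReal, map_one, Complex.conj_conj]
  ring

lemma Matrix.IsHermitian.PT {dA dB : ℕ}
    {ρ : Matrix (Fin dA × Fin dB) (Fin dA × Fin dB) ℂ} (h : ρ.IsHermitian) :
    (PT ρ).IsHermitian := by
  ext x y
  exact h.apply _ _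

/-- if `⟨00|ρ₀|00⟩ = 0`, `⟨10|ρ₀|01⟩ = 0`, `⟨00|ρ₁|00⟩ = 0` and
`⟨10|ρ₁|01⟩ ≠ 0`, then `ρ_ε = (1−ε)ρ₀ + ερ₁` is entangled for `0 < ε ≤ 1`; moreover
some `Ψ = a|00⟩ + b|11⟩` satisfies `⟨Ψ|PT(ρ_ε)|Ψ⟩ < 0`. -/
theorem stmt_9 (dA dB : ℕ) (hA : 2 ≤ dA) (hB : 2 ≤ dB)
    (ρ0 ρ1 : Matrix (Fin dA × Fin dB) (Fin dA × Fin dB) ℂ)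
    (h0 : IsState ρ0) (h1 : IsState ρ1)
    (h00ρ0 : braket (vecKron (bv (d := dA) 0 (by omega)) (bv (d := dB) 0 (by omega))) ρ0
        (vecKron (bv (d := dA) 0 (by omega)) (bv (d := dB) 0 (by omega))) = 0)
    (h10ρ0 : braket (vecKron (bv (d := dA) 1 (by omega)) (bv (d := dB) 0 (by omega))) ρ0
        (vecKron (bv (d := dA) 0 (by omega)) (bv (d := dB) 1 (by omega))) = 0)
    (h00ρ1 : braket (vecKron (bv (d := dA) 0 (by omega)) (bv (d := dB) 0 (by omega))) ρ1
        (vecKron (bv (d := dA) 0 (by omega)) (bv (d := dB) 0 (by omega))) = 0)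
    (h10ρ1 : braket (vecKron (bv (d := dA) 1 (by omega)) (bv (d := dB) 0 (by omega))) ρ1
        (vecKron (bv (d := dA) 0 (by omega)) (bv (d := dB) 1 (by omega))) ≠ 0) :
    ∀ ε : ℝ, 0 < ε → ε ≤ 1 →
      EntangledState ((1 - (ε : ℂ)) • ρ0 + (ε : ℂ) • ρ1) ∧
      ∃ a b : ℂ, ∃ r : ℝ, r < 0 ∧
        braket
          (a • vecKron (bv (d := dA) 0 (by omega)) (bv (d := dB) 0 (by omega)) +
            b • vecKron (bv (d := dA) 1 (by omega)) (bv (d := dB) 1 (by omega)))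
          (PT ((1 - (ε : ℂ)) • ρ0 + (ε : ℂ) • ρ1))
          (a • vecKron (bv (d := dA) 0 (by omega)) (bv (d := dB) 0 (by omega)) +
            b • vecKron (bv (d := dA) 1 (by omega)) (bv (d := dB) 1 (by omega))) = (r : ℂ) := by
  intro ε hε0 hε1
  simp only [vecKron_bv, braket_single] at *
  have hρ := h0.convexComb h1 hε0.le hε1
  have hneg := exists_braket_neg hρ.1.isHermitian.PT
    (x := (⟨0, by omega⟩, ⟨0, by omega⟩)) (y := (⟨1, by omega⟩, ⟨1, by omega⟩))
    (by simp [PT, h00ρ0, h00ρ1])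
    (by simpa [PT, h10ρ0, hε0.ne'] using h10ρ1)
  refine ⟨⟨hρ, fun hsep => ?_⟩, hneg⟩
  obtain ⟨a, b, r, hr, h⟩ := hneg
  have hnn := hsep.posSemidef_PT.dotProduct_mulVec_nonneg
    (a • Pi.single (⟨0, by omega⟩, ⟨0, by omega⟩) 1 +
      b • Pi.single (⟨1, by omega⟩, ⟨1, by omega⟩) 1)
  rw [← braket, h] at hnn
  exact hr.not_ge (by exact_mod_cast hnn)
end
end
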